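/- Let H(x) be a J × L matrix over R = F_2[x]/(x^N - 1), let T ⊂ {0,...,J-1} be a set of row indices and H'(x) the submatrix of H(x) with the rows indexed by T removed. Let S ⊆ {0,...,L-1} with |S| = J + 1 - |T|, and suppose that for every t ∈ T, the (J+1-|T|) × (J+1-|T|) matrix formed by stacking the sub-row h_{t,S}(x) on top of H'_S(x) has zero permanent. Define c(x) ∈ R^L by c_i(x) = perm(H'_{S\i}(x)) for i ∈ S and c_i(x) = 0 otherwise. Then H(x)·c(x)^T = 0. -/

import Mathlib

open Polynomial

/-- The quotient ring `F₂[x]/(x^N - 1)`. -/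
noncomputable abbrev Rq (N : ℕ) : Type := AdjoinRoot (X ^ N - C 1 : (ZMod 2)[X])

/-- The permanent of a square matrix over a commutative ring. -/
def perm {R : Type*} [CommRing R] {n : ℕ} (B : Matrix (Fin n) (Fin n) R) : R :=
  ∑ σ : Equiv.Perm (Fin n), ∏ j, B j (σ j)

theorem perm_eq_det {R : Type*} [CommRing R] (h : (-1 : R) = 1) {n : ℕ}
    (B : Matrix (Fin n) (Fin n) R) : perm B = B.det := by
  rw [← Matrix.det_transpose, Matrix.det_apply']
  refine Finset.sum_congr rfl fun σ _ => ?_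
  rcases Int.units_eq_one_or (Equiv.Perm.sign σ) with hσ | hσ <;> simp [hσ, h]

theorem perm_succ_row_zero {R : Type*} [CommRing R] (h : (-1 : R) = 1) {n : ℕ}
    (B : Matrix (Fin (n + 1)) (Fin (n + 1)) R) :
    perm B = ∑ j, B 0 j * perm (B.submatrix Fin.succ j.succAbove) := by
  simp only [perm_eq_det h, Matrix.det_succ_row_zero B, h, one_pow, one_mul]

theorem Rq.neg_one_eq_one (N : ℕ) : (-1 : Rq N) = 1 := by
  have h : (-1 : ZMod 2) = 1 := by decide
  rw [← map_one (algebraMap (ZMod 2) (Rq N)), ← map_neg, h]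

/-- Erasing the `k`-th element of a finset skips the index `k` in its increasing enumeration. -/
theorem Finset.orderIsoOfFin_erase_apply {α : Type*} [LinearOrder α] {n : ℕ} (S : Finset α)
    (hS : S.card = n + 1) (k : Fin (n + 1)) {i : α} (hi : (S.orderIsoOfFin hS k : α) = i)
    (hE : (S.erase i).card = n) (l : Fin n) :
    ((S.erase i).orderIsoOfFin hE l : α) = S.orderIsoOfFin hS (k.succAbove l) := by
  subst hi
  have key := Finset.orderEmbOfFin_unique hE
    (f := fun l => (S.orderIsoOfFin hS (k.succAbove l) : α))
    (fun x => Finset.mem_erase.2 ⟨fun h => Fin.succAbove_ne k x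
      ((S.orderIsoOfFin hS).injective (Subtype.ext h)), Subtype.property _⟩)
    (fun a b hab => (S.orderIsoOfFin hS).strictMono (Fin.strictMono_succAbove k hab))
  exact (congrFun key l).symm

/-- Codeword construction with row removal: let `H'(x)` be the submatrix of the
`J × L` matrix `H(x)` over `F₂[x]/(x^N - 1)` with the rows indexed by `T` removed
(`rowsel` enumerates the retained rows `Tᶜ` in order), and let `S` be a set of
`J + 1 - |T|` columns (`colS` enumerates `S` in order).  If, for every removed row
`t ∈ T`, the square matrix obtained by stacking the sub-row `h_{t,S}(x)` on top of
`H'_S(x)` has zero permanent, then the vector `c(x)` defined by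
`c_i(x) = perm(H'_{S∖i}(x))` for `i ∈ S` and `c_i(x) = 0` otherwise satisfies
`H(x)·c(x)ᵀ = 0`. -/
theorem perm_vector_with_row_removal_is_codeword {N J L : ℕ} (hN : 0 < N)
    (H : Matrix (Fin J) (Fin L) (Rq N))
    (T : Finset (Fin J)) (hT : T ⊂ Finset.univ)
    (S : Finset (Fin L)) (hS : S.card = J + 1 - T.card)
    (rowsel : Fin (J - T.card) → Fin J)
    (hrowsel : ∀ r, rowsel r =
      ((Tᶜ.orderIsoOfFin (by simp [Finset.card_compl])) r : Fin J))
    (colS : Fin (J - T.card + 1) → Fin L)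
    (hcolS : ∀ k, colS k =
      ((S.orderIsoOfFin (by
        have h := Finset.card_le_univ T
        simp only [Finset.card_univ, Fintype.card_fin] at h
        omega)) k : Fin L))
    (hperm : ∀ t ∈ T,
      perm (Matrix.of (Fin.cons (fun cc => H t (colS cc))
        (fun r cc => H (rowsel r) (colS cc)))) = 0)
    (c : Fin L → Rq N)
    (hc : ∀ i, ∀ hi : i ∈ S,
      c i = perm (Matrix.of fun r k : Fin (J - T.card) =>
        H (rowsel r) (((S.erase i).orderIsoOfFin (by
          have h := Finset.card_le_univ T
          simp only [Finset.card_univ, Fintype.card_fin] at h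
          rw [Finset.card_erase_of_mem hi, hS]
          omega) k : Fin L))))
    (hc0 : ∀ i, i ∉ S → c i = 0) :
    H.mulVec c = 0 := by
  have hTc : T.card ≤ J := by simpa using Finset.card_le_univ T
  have hS' : S.card = J - T.card + 1 := by omega
  have hneg := Rq.neg_one_eq_one N
  have hmem : ∀ k, colS k ∈ S := fun k => by
    rw [hcolS]
    exact Subtype.property _
  have hcol : ∀ k, c (colS k) = perm (Matrix.of fun r l : Fin (J - T.card) =>
      H (rowsel r) (colS (k.succAbove l))) := fun k => by
    rw [hc _ (hmem k)]
    congr 1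
    ext r l
    simp only [Matrix.of_apply]
    rw [hcolS (k.succAbove l)]
    exact congrArg (H (rowsel r))
      (Finset.orderIsoOfFin_erase_apply S hS' k (hcolS k).symm _ l)
  have hinj : Function.Injective colS := fun a b hab => by
    rw [hcolS, hcolS] at hab
    exact (S.orderIsoOfFin hS').injective (Subtype.ext hab)
  have himage : Finset.univ.image colS = S :=
    Finset.eq_of_subset_of_card_le (by simpa [Finset.subset_iff] using hmem)
      (by rw [Finset.card_image_of_injective _ hinj, hS']; simp)
  funext j
  have hexpand : H.mulVec c j = perm (Matrix.of (Fin.cons (fun cc => H j (colS cc))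
      (fun r cc => H (rowsel r) (colS cc)))) := by
    rw [perm_succ_row_zero hneg]
    calc ∑ i, H j i * c i = ∑ i ∈ S, H j i * c i :=
          (Finset.sum_subset (Finset.subset_univ S) fun i _ hi => by
            rw [hc0 i hi, mul_zero]).symm
      _ = ∑ k, H j (colS k) * c (colS k) := by
          rw [← himage, Finset.sum_image hinj.injOn]
      _ = _ := Finset.sum_congr rfl fun k _ => by
          rw [hcol]
          rfl
  rw [hexpand, Pi.zero_apply]
  by_cases hj : j ∈ T
  · exact hperm j hj
  · obtain ⟨r, hr⟩ := (Tᶜ.orderIsoOfFin (k := J - T.card)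
      (by simp [Finset.card_compl])).surjective ⟨j, Finset.mem_compl.2 hj⟩
    have hrj : rowsel r = j := by rw [hrowsel, hr]
    rw [perm_eq_det hneg]
    refine Matrix.det_zero_of_row_eq (Fin.succ_ne_zero r).symm ?_
    funext k
    simp [hrj]
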